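/- Fix λ > 0. For ω ∈ ℕ^ℕ and k ≥ 1, let E_k(ω) be the number of indices i ∈ {1,…,k} such that node i lies on an even level of the tree encoded by ω. Then there exist constants C, c > 0 such that for all k ≥ 1, P_λ({ω : E_k(ω) ≤ ⌊k/(2λ + 1)⌋ and the tree encoded by ω has at least k vertices}) ≤ C e^{−ck}. -/

import Mathlib

open MeasureTheory ProbabilityTheory Filter Topology

/-- `P` is the family of laws of a sequence of i.i.d. Poisson(λ) random variables:
for each `λ > 0`, `P λ` is a probability measure on `ℕ → ℕ` whose finite-dimensional
marginals are finite products of Poisson(λ) distributions.  This characterizes the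
countable product of Poisson(λ) measures on `ℕ^ℕ`. -/
def IsPoissonSeedFamily (P : ℝ → Measure (ℕ → ℕ)) : Prop :=
  ∀ lam : ℝ, 0 < lam → IsProbabilityMeasure (P lam) ∧
    ∀ k : ℕ, (P lam).map (fun ω (j : Fin k) => ω j.1)
      = Measure.pi (fun _ : Fin k => poissonMeasure lam.toNNReal)

/-- The first `k` coordinates `(ω₁, …, ω_k)` of a seed `ω ∈ ℕ^ℕ` (0-indexed). -/
def restrictSeed (k : ℕ) (ω : ℕ → ℕ) : Fin k → ℕ := fun j => ω j.1

/-- An event is `k`-tautologically determined if it is of the form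
`{ω : (ω₁, …, ω_k) ∈ B}` for some `B ⊆ ℕ^k`. -/
def TautDetermined (k : ℕ) (A : Set (ℕ → ℕ)) : Prop :=
  ∃ B : Set (Fin k → ℕ), A = {ω | restrictSeed k ω ∈ B}

/-- The tree encoded by the seed `ω` in breadth-first order (node `i+1` has `ω i`
children) has at least `k` vertices: `ω₁ + ⋯ + ω_j ≥ j` for every `1 ≤ j ≤ k - 1`. -/
def treeAtLeast (ω : ℕ → ℕ) (k : ℕ) : Prop :=
  ∀ j : ℕ, 1 ≤ j → j ≤ k - 1 → j ≤ ∑ i ∈ Finset.range j, ω i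

/-- The 0-based index of the parent of the node of 0-based index `i` (for `i ≥ 1`):
the least `p` such that `ω₁ + ⋯ + ω_{p+1} ≥ i`. -/
noncomputable def parent (ω : ℕ → ℕ) (i : ℕ) : ℕ :=
  sInf {p : ℕ | i ≤ ∑ t ∈ Finset.range (p + 1), ω t}

/-- The level of the node of 0-based index `i`: the root (index `0`) has level `0`,
and the level of any other node is one plus the level of its parent. -/
noncomputable def level (ω : ℕ → ℕ) (i : ℕ) : ℕ :=
  if h : parent ω i < i then level ω (parent ω i) + 1 else 0
termination_by i
decreasing_by exact h

/-- The number of nodes among the first `k` lying on an even level of the tree. -/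
noncomputable def evenCount (ω : ℕ → ℕ) (k : ℕ) : ℕ :=
  ((Finset.range k).filter fun i => Even (level ω i)).card

lemma parent_spec (ω : ℕ → ℕ) {i : ℕ} (hi : 1 ≤ i) (h : i ≤ ∑ t ∈ Finset.range i, ω t) :
    parent ω i < i ∧ i ≤ ∑ t ∈ Finset.range (parent ω i + 1), ω t ∧
      ∑ t ∈ Finset.range (parent ω i), ω t < i := by
  have hmem : (i - 1) ∈ {p : ℕ | i ≤ ∑ t ∈ Finset.range (p + 1), ω t} := by
    have : i - 1 + 1 = i := by omega
    simp only [Set.mem_ofPred_eq, this]; exact h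
  refine ⟨?_, Nat.sInf_mem (s := {p : ℕ | i ≤ ∑ t ∈ Finset.range (p + 1), ω t}) ⟨_, hmem⟩, ?_⟩
  · have : parent ω i ≤ i - 1 := Nat.sInf_le hmem
    omega
  · by_contra hc
    push Not at hc
    rcases hp : parent ω i with _ | q
    · rw [hp] at hc; simp at hc; omega
    · have : parent ω i ≤ q := Nat.sInf_le (by rw [hp] at hc; exact hc)
      omega

lemma sum_mono_range (ω : ℕ → ℕ) {a b : ℕ} (h : a ≤ b) :
    ∑ t ∈ Finset.range a, ω t ≤ ∑ t ∈ Finset.range b, ω t :=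
  Finset.sum_le_sum_of_subset (Finset.range_mono h)

lemma parent_unique (ω : ℕ → ℕ) {i p q : ℕ}
    (h1 : i ≤ ∑ t ∈ Finset.range (p + 1), ω t) (h2 : ∑ t ∈ Finset.range p, ω t < i)
    (h3 : i ≤ ∑ t ∈ Finset.range (q + 1), ω t) (h4 : ∑ t ∈ Finset.range q, ω t < i) : p = q := by
  rcases lt_trichotomy p q with h | h | h
  · have := sum_mono_range ω (show p + 1 ≤ q by omega); omega
  · exact h
  · have := sum_mono_range ω (show q + 1 ≤ p by omega); omega

lemma level_congr (ω ω' : ℕ → ℕ) : ∀ i : ℕ, (∀ t < i, ω t = ω' t) →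
    (∀ j, 1 ≤ j → j ≤ i → j ≤ ∑ t ∈ Finset.range j, ω t) → level ω i = level ω' i := by
  intro i
  induction i using Nat.strong_induction_on with
  | _ i ih =>
    intro hag ht
    rcases Nat.eq_zero_or_pos i with h0 | hpos
    · subst h0
      rw [level.eq_1 ω, level.eq_1 ω']; simp
    · have hs : ∀ j ≤ i, ∑ t ∈ Finset.range j, ω t = ∑ t ∈ Finset.range j, ω' t := by
        intro j hj
        refine Finset.sum_congr rfl fun t htt => hag t ?_
        have := Finset.mem_range.1 htt
        omega
      obtain ⟨a1, a2, a3⟩ := parent_spec ω hpos (ht i hpos le_rfl)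
      obtain ⟨b1, b2, b3⟩ := parent_spec ω' hpos (by rw [← hs i le_rfl]; exact ht i hpos le_rfl)
      have heq : parent ω i = parent ω' i := by
        rw [← hs _ (by omega)] at b2 b3
        exact parent_unique ω a2 a3 b2 b3
      rw [level.eq_1 ω i, level.eq_1 ω' i, dif_pos a1, dif_pos b1, ← heq]
      congr 1
      exact ih _ a1 (fun t htt => hag t (by omega)) (fun j h1 h2 => ht j h1 (by omega))

lemma odd_le_sum (ω : ℕ → ℕ) (k : ℕ) (ht : treeAtLeast ω k) :
    k ≤ evenCount ω k + ∑ i ∈ (Finset.range k).filter (fun i => Even (level ω i)), ω i := by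
  have hsplit := Finset.card_filter_add_card_filter_not (s := Finset.range k)
    (fun i => Even (level ω i))
  rw [Finset.card_range] at hsplit
  have hsub : (Finset.range k).filter (fun i => ¬ Even (level ω i)) ⊆
      ((Finset.range k).filter (fun i => Even (level ω i))).biUnion
        (fun p => Finset.Ioc (∑ t ∈ Finset.range p, ω t) (∑ t ∈ Finset.range (p + 1), ω t)) := by
    intro i hi
    rw [Finset.mem_filter, Finset.mem_range] at hi
    obtain ⟨hik, hodd⟩ := hi
    have hpos : 1 ≤ i := by
      rcases Nat.eq_zero_or_pos i with h0 | h0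
      · subst h0; rw [level] at hodd; simp at hodd
      · exact h0
    obtain ⟨a1, a2, a3⟩ := parent_spec ω hpos (ht i hpos (by omega))
    rw [level, dif_pos a1, Nat.even_add_one, not_not] at hodd
    simp only [Finset.mem_biUnion, Finset.mem_filter, Finset.mem_range, Finset.mem_Ioc]
    exact ⟨parent ω i, ⟨by omega, hodd⟩, a3, a2⟩
  have h2 := (Finset.card_le_card hsub).trans Finset.card_biUnion_le
  simp only [Nat.card_Ioc, Finset.sum_range_succ, Nat.add_sub_cancel_left] at h2
  unfold evenCount
  omega

open Classical in
lemma lintegral_predictable (μ : Measure ℕ) [IsProbabilityMeasure μ] (h : ℕ → ENNReal)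
    (hh : ∫⁻ n, h n ∂μ ≤ 1) (e : ∀ i : ℕ, (Fin i → ℕ) → Prop) : ∀ k : ℕ,
    ∫⁻ x : Fin k → ℕ, ∏ i : Fin k,
      (if e i.1 (fun j => x (Fin.castLE i.2.le j)) then h (x i) else 1)
        ∂Measure.pi (fun _ => μ) ≤ 1 := by
  intro k
  induction k with
  | zero => simp
  | succ k ih =>
    have hmp := measurePreserving_piFinSuccAbove (fun _ : Fin (k + 1) => μ) (Fin.last k)
    rw [← hmp.symm.lintegral_comp (Measurable.of_discrete),
      lintegral_prod_symm' _ (Measurable.of_discrete)]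
    refine le_trans (lintegral_mono fun y => ?_) ih
    simp only [Fin.prod_univ_castSucc]
    have key : ∀ x : ℕ, ((MeasurableEquiv.piFinSuccAbove (fun _ : Fin (k+1) => ℕ)
        (Fin.last k)).symm (x, y)) = Fin.snoc (α := fun _ => ℕ) y x := by
      intro x
      simp [MeasurableEquiv.piFinSuccAbove]
      rfl
    simp only [key, Fin.snoc_castSucc, Fin.snoc_last, Fin.val_castSucc, Fin.val_last]
    have hc1 : ∀ (x : ℕ) (i : Fin k), (fun j : Fin i.1 => (Fin.snoc (α := fun _ => ℕ) y x)
        (Fin.castLE (Fin.castSucc i).2.le j)) = fun j : Fin i.1 => y (Fin.castLE i.2.le j) := by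
      intro x i
      funext j
      exact Fin.snoc_castSucc (α := fun _ => ℕ) x y (Fin.castLE i.2.le j)
    have hc2 : ∀ (x : ℕ), (fun j : Fin k => (Fin.snoc (α := fun _ => ℕ) y x)
        (Fin.castLE (Fin.last k).2.le j)) = y := by
      intro x
      funext j
      exact Fin.snoc_castSucc (α := fun _ => ℕ) x y j
    have hcongr : ∀ x : ℕ, _ = _ := fun x => congrArg₂ (fun a b : ENNReal => a * b)
      (Finset.prod_congr (s₁ := Finset.univ) rfl fun (i : Fin k) _ =>
        congrArg (fun z => if e i.1 z then h (y i) else 1) (hc1 x i))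
      (congrArg (fun z => if e k z then h x else 1) (hc2 x))
    refine (lintegral_congr hcongr).trans_le ?_
    rw [lintegral_const_mul _ (Measurable.of_discrete)]
    refine mul_le_of_le_one_right' ?_
    by_cases he : e k y
    · simpa [he] using hh
    · simp [he]

lemma poisson_mgf (lam : ℝ) (hlam : 0 < lam) :
    ∫⁻ n : ℕ, ENNReal.ofReal (Real.exp (n - lam * (Real.exp 1 - 1)))
      ∂(poissonMeasure lam.toNNReal) ≤ 1 := by
  rw [lintegral_countable']
  simp only [poissonMeasure_singleton, Real.coe_toNNReal lam hlam.le]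
  have hs : HasSum (fun n : ℕ => Real.exp (n - lam * (Real.exp 1 - 1)) *
      (Real.exp (-lam) * lam ^ n / (n.factorial : ℝ))) 1 := by
    have h1 := (NormedSpace.expSeries_div_hasSum_exp (lam * Real.exp 1)).mul_left
      (Real.exp (-(lam * Real.exp 1)))
    rw [← Real.exp_eq_exp_ℝ, ← Real.exp_add, neg_add_cancel, Real.exp_zero] at h1
    refine (congrArg (fun f : ℕ → ℝ => HasSum f 1) (funext fun n => ?_)).mpr h1
    rw [mul_pow, ← Real.exp_nat_mul, mul_one]
    have : Real.exp (n - lam * (Real.exp 1 - 1)) * Real.exp (-lam)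
        = Real.exp (-(lam * Real.exp 1)) * Real.exp n := by
      rw [← Real.exp_add, ← Real.exp_add]; ring_nf
    rw [← mul_div_assoc, ← mul_assoc, this]; ring
  simp_rw [← ENNReal.ofReal_mul (Real.exp_nonneg _)]
  rw [← ENNReal.ofReal_tsum_of_nonneg (fun n => by positivity) hs.summable, hs.tsum_eq]
  simp

/-- Predictable version of the event that node `i` is on an even level. -/
def predEven (i : ℕ) (x : Fin i → ℕ) : Prop :=
  Even (level (fun t => if h : t < i then x ⟨t, h⟩ else 0) i)

lemma predEven_iff (ω : ℕ → ℕ) (k i : ℕ) (hi : i < k) (ht : treeAtLeast ω k) :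
    predEven i (fun j => ω j.1) ↔ Even (level ω i) := by
  unfold predEven
  rw [level_congr ω (fun t => if h : t < i then ω t else 0) i
    (fun t h => by simp [h]) (fun j h1 h2 => ht j h1 (by omega))]

/-- For fixed `λ > 0`, the probability that the tree has at least `k` vertices while at
most `⌊k/(2λ+1)⌋` of the first `k` nodes lie on an even level decays exponentially. -/
theorem few_even_nodes_tail
    (P : ℝ → Measure (ℕ → ℕ)) (hP : IsPoissonSeedFamily P)
    (lam : ℝ) (hlam : 0 < lam) :
    ∃ C > (0 : ℝ), ∃ c > (0 : ℝ), ∀ k : ℕ, 1 ≤ k →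
      P lam {ω | evenCount ω k ≤ ⌊(k : ℝ) / (2 * lam + 1)⌋₊ ∧ treeAtLeast ω k}
        ≤ ENNReal.ofReal (C * Real.exp (-c * k)) := by
  classical
  obtain ⟨hprob, hmarg⟩ := hP lam hlam
  have he3 : Real.exp 1 < 3 := by have := Real.exp_one_lt_d9; linarith
  set c : ℝ := lam * (3 - Real.exp 1) / (2 * lam + 1) with hc
  have hcpos : 0 < c := by
    have : 0 < 3 - Real.exp 1 := by linarith
    positivity
  refine ⟨1, one_pos, c, hcpos, fun k _ => ?_⟩
  set a : ℝ := lam * (Real.exp 1 - 1) with ha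
  have hapos : 0 < a := mul_pos hlam (by have := Real.exp_one_gt_d9; linarith)
  let h : ℕ → ENNReal := fun n => ENNReal.ofReal (Real.exp (n - a))
  let F : (Fin k → ℕ) → ENNReal := fun x => ∏ i : Fin k,
      (if predEven i.1 (fun j => x (Fin.castLE i.2.le j)) then h (x i) else 1)
  have hF : ∫⁻ x, F x ∂Measure.pi (fun _ : Fin k => poissonMeasure lam.toNNReal) ≤ 1 :=
    lintegral_predictable _ h (poisson_mgf lam hlam) predEven k
  have hsub : {ω | evenCount ω k ≤ ⌊(k : ℝ) / (2 * lam + 1)⌋₊ ∧ treeAtLeast ω k} ⊆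
      (fun ω (j : Fin k) => ω j.1) ⁻¹' {x | ENNReal.ofReal (Real.exp (c * k)) ≤ F x} := by
    rintro ω ⟨hE, ht⟩
    simp only [Set.mem_preimage, Set.mem_ofPred_eq]
    have hFeq : F (fun j => ω j.1) = ENNReal.ofReal (Real.exp
        (∑ i ∈ (Finset.range k).filter (fun i => Even (level ω i)), ((ω i : ℝ) - a))) := by
      rw [Real.exp_sum, ENNReal.ofReal_prod_of_nonneg (fun _ _ => Real.exp_nonneg _),
        Finset.prod_filter, Finset.prod_range]
      refine Finset.prod_congr rfl fun i _ => ?_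
      have := predEven_iff ω k i.1 i.2 ht
      simp only [Fin.val_castLE, this, h]
    rw [hFeq]
    apply ENNReal.ofReal_le_ofReal
    apply Real.exp_le_exp.2
    rw [Finset.sum_sub_distrib, Finset.sum_const, nsmul_eq_mul]
    have hodd := odd_le_sum ω k ht
    have hodd' : (k : ℝ) ≤ evenCount ω k +
        ∑ i ∈ (Finset.range k).filter (fun i => Even (level ω i)), (ω i : ℝ) := by
      exact_mod_cast hodd
    have hE' : (evenCount ω k : ℝ) ≤ (k : ℝ) / (2 * lam + 1) :=
      (Nat.cast_le.2 hE).trans (Nat.floor_le (by positivity))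
    change _ ≤ _ - (evenCount ω k : ℝ) * a
    have h3 : (evenCount ω k : ℝ) * (1 + a) ≤ (k : ℝ) / (2 * lam + 1) * (1 + a) :=
      mul_le_mul_of_nonneg_right hE' (by linarith)
    have h4 : c * k = k - (k : ℝ) / (2 * lam + 1) * (1 + a) := by
      rw [hc, ha]; field_simp; ring
    linarith
  have hmeas : Measurable (fun (ω : ℕ → ℕ) (j : Fin k) => ω j.1) := by fun_prop
  refine (measure_mono hsub).trans ?_
  rw [← Measure.map_apply hmeas (MeasurableSet.of_discrete), hmarg k]
  have hM := (mul_meas_ge_le_lintegral (μ := Measure.pi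
    (fun _ : Fin k => poissonMeasure lam.toNNReal)) (f := F) Measurable.of_discrete
    (ENNReal.ofReal (Real.exp (c * k)))).trans hF
  have hinv : ENNReal.ofReal (1 * Real.exp (-c * k)) = (ENNReal.ofReal (Real.exp (c * k)))⁻¹ := by
    rw [← ENNReal.ofReal_inv_of_pos (Real.exp_pos _), ← Real.exp_neg, one_mul, neg_mul]
  rw [hinv]
  rw [ENNReal.le_inv_iff_mul_le, mul_comm]
  exact hM
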